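/- arXiv:math/0612292 — 2 statements merged into one kernel-verified Lean document; each statement's English description precedes it below -/
import Mathlib

section
/- Let φ be an automorphism of the symmetric group S_6 that is not inner (i.e., there is no x ∈ S_6 with φ(g) = x g x⁻¹ for all g). Then φ interchanges the following pairs of conjugacy classes: for every g ∈ S_6, if g has cycle type {6} then φ(g) has cycle type {3, 2} and vice versa; if g has cycle type {3, 3} then φ(g) has cycle type {3} and vice versa; and if g has cycle type {2, 2, 2} then φ(g) has cycle type {2} and vice versa. -/
open Equiv Equiv.Perm

section IsSwap

variable {α : Type*} [DecidableEq α]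

lemma swap_left_injective (x : α) : Function.Injective (swap x) := fun a b h => by
  simpa using congrArg (fun f : Perm α => f x) h

lemma not_commute_swap {x a b : α} (hxa : x ≠ a) (hxb : x ≠ b) (hab : a ≠ b) :
    ¬ Commute (swap x a) (swap x b) := fun h => by
  have := congrArg (fun f : Perm α => f x) h.eq
  simp [swap_apply_of_ne_of_ne hxb.symm hab.symm, swap_apply_of_ne_of_ne hxa.symm hab] at this
  exact hab this.symm

lemma commute_swap_of_ne {x y u v : α} (hxu : x ≠ u) (hxv : x ≠ v) (hyu : y ≠ u) (hyv : y ≠ v) :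
    Commute (swap x y) (swap u v) := by
  rcases eq_or_ne x y with rfl | hxy
  · simp [Perm.one_def.symm]
  rcases eq_or_ne u v with rfl | huv
  · simp [Perm.one_def.symm]
  · exact (disjoint_swap_swap (by simp [*])).commute

lemma exists_common_of_not_commute {s t : Perm α} (hs : s.IsSwap) (ht : t.IsSwap)
    (h : ¬ Commute s t) :
    ∃ x a b, x ≠ a ∧ x ≠ b ∧ a ≠ b ∧ s = swap x a ∧ t = swap x b := by
  obtain ⟨x, a, hxa, rfl⟩ := hs
  obtain ⟨u, v, huv, rfl⟩ := ht
  have key : ∀ {x a b : α}, x ≠ a → x ≠ b → ¬ Commute (swap x a) (swap x b) →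
      ∃ y c d, y ≠ c ∧ y ≠ d ∧ c ≠ d ∧ swap x a = swap y c ∧ swap x b = swap y d :=
    fun {x a b} hxa hxb h => ⟨x, a, b, hxa, hxb, by rintro rfl; exact h rfl, rfl, rfl⟩
  by_cases hxu : x = u
  · subst hxu
    exact key hxa huv h
  by_cases hxv : x = v
  · subst hxv
    rw [swap_comm u x] at h ⊢
    exact key hxa huv.symm h
  by_cases hau : a = u
  · subst hau
    rw [swap_comm x a] at h ⊢
    exact key hxa.symm huv h
  by_cases hav : a = v
  · subst hav
    rw [swap_comm x a, swap_comm u a] at h ⊢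
    exact key hxa.symm huv.symm h
  · exact absurd (commute_swap_of_ne hxu hxv hau hav) h

lemma exists_eq_swap_of_not_commute {r : Perm α} (hr : r.IsSwap) {x a b : α} (hab : a ≠ b)
    (ha : ¬ Commute (swap x a) r) (hb : ¬ Commute (swap x b) r) (hne : r ≠ swap a b) :
    ∃ c, r = swap x c := by
  obtain ⟨u, v, huv, rfl⟩ := hr
  by_cases hxu : x = u
  · exact ⟨v, by rw [hxu]⟩
  by_cases hxv : x = v
  · exact ⟨u, by rw [hxv, swap_comm]⟩
  have mem : ∀ y, ¬ Commute (swap x y) (swap u v) → y = u ∨ y = v := fun y hy => by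
    by_contra! hyuv
    exact hy (commute_swap_of_ne hxu hxv hyuv.1 hyuv.2)
  rcases mem a ha with rfl | rfl <;> rcases mem b hb with rfl | rfl
  · exact absurd rfl hab
  · exact absurd rfl hne
  · exact absurd (swap_comm _ _) hne
  · exact absurd rfl hab

/-- An automorphism of a finite symmetric group that preserves transpositions is inner. -/
theorem exists_conj_of_map_isSwap [Fintype α] (hα : 2 < Fintype.card α) (φ : Perm α ≃* Perm α)
    (hφ : ∀ t : Perm α, t.IsSwap → (φ t).IsSwap) :
    ∃ x : Perm α, ∀ g, φ g = x * g * x⁻¹ := by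
  obtain ⟨o, p, q, hop, hoq, hpq⟩ := Fintype.two_lt_card_iff.mp hα
  have hncomm : ∀ i j, o ≠ i → o ≠ j → i ≠ j → ¬ Commute (φ (swap o i)) (φ (swap o j)) :=
    fun i j hi hj hij h => not_commute_swap hi hj hij ((commute_map_iff φ.injective).mp h)
  have hsw : ∀ i, o ≠ i → (φ (swap o i)).IsSwap := fun i hi => hφ _ ⟨o, i, hi, rfl⟩
  obtain ⟨x, a, b, hxa, hxb, hab, hp, hq⟩ :=
    exists_common_of_not_commute (hsw p hop) (hsw q hoq) (hncomm p q hop hoq hpq)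
  have hpq' : φ (swap p q) = swap a b := by
    rw [swap_comm p, ← swap_mul_swap_mul_swap hop.symm hpq, swap_comm a,
      ← swap_mul_swap_mul_swap hxa.symm hab, swap_comm p o, swap_comm a x, map_mul, map_mul, hp, hq]
  have hex : ∀ i, ∃ c, φ (swap o i) = swap x c := fun i => by
    by_cases hoi : o = i
    · exact ⟨x, by simp [← hoi, ← Perm.one_def]⟩
    by_cases hpi : p = i
    · exact ⟨a, hpi ▸ hp⟩
    by_cases hqi : q = i
    · exact ⟨b, hqi ▸ hq⟩
    refine exists_eq_swap_of_not_commute (hsw i hoi) hab (hp ▸ hncomm p i hop hoi hpi)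
      (hq ▸ hncomm q i hoq hoi hqi) fun h => ?_
    have := congrArg (fun f : Perm α => f o) (φ.injective (h.trans hpq'.symm))
    simp [swap_apply_of_ne_of_ne hop hoq] at this
    exact hoi this.symm
  choose c hc using hex
  have hinj : Function.Injective c := fun i j hij =>
    swap_left_injective o (φ.injective (by rw [hc, hc, hij]))
  have hco : c o = x := swap_left_injective x (by rw [← hc]; simp [← Perm.one_def])
  let e : Perm α := Equiv.ofBijective c (Finite.injective_iff_bijective.mp hinj)
  have hstar : ∀ i, φ (swap o i) = MulAut.conj e (swap o i) := fun i => by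
    rw [MulAut.conj_apply, ← swap_apply_apply, hc]
    simp [e, hco]
  have heq : φ.toMonoidHom = (MulAut.conj e).toMonoidHom := by
    refine MonoidHom.eq_of_eqOn_dense closure_isSwap ?_
    rintro _ ⟨i, j, hij, rfl⟩
    change φ (swap i j) = MulAut.conj e (swap i j)
    by_cases hoj : o = j
    · rw [swap_comm, ← hoj, hstar]
    · rw [← swap_mul_swap_mul_swap (Ne.symm hoj) hij.symm, swap_comm j o]
      simp only [map_mul, hstar]
  exact ⟨e, fun g => DFunLike.congr_fun heq g⟩

end IsSwap

section Automorphism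

variable {α : Type*} [DecidableEq α] [Fintype α]

lemma sign_map_mulEquiv [Nontrivial α] (φ : Perm α ≃* Perm α) (g : Perm α) :
    sign (φ g) = sign g :=
  DFunLike.congr_fun (eq_sign_of_surjective_hom (s := sign.comp φ.toMonoidHom)
    ((sign_surjective α).comp φ.surjective)) g

lemma cycleType_map_congr (φ : Perm α ≃* Perm α) {g h : Perm α} (hgh : g.cycleType = h.cycleType) :
    (φ g).cycleType = (φ h).cycleType :=
  isConj_iff_cycleType_eq.mp (φ.toMonoidHom.map_isConj (isConj_iff_cycleType_eq.mpr hgh))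

lemma cycleType_pow_congr {g h : Perm α} (hgh : g.cycleType = h.cycleType) (n : ℕ) :
    (g ^ n).cycleType = (h ^ n).cycleType :=
  isConj_iff_cycleType_eq.mp (IsConj.pow n (isConj_iff_cycleType_eq.mpr hgh))

end Automorphism

lemma cycleType_of_orderOf_eq_two_of_sign {g : Perm (Fin 6)} (h2 : orderOf g = 2)
    (hs : sign g = -1) : g.cycleType = {2} ∨ g.cycleType = {2, 2, 2} := by
  obtain ⟨n, hn⟩ := cycleType_prime_order (σ := g) (h2 ▸ Nat.prime_two)
  rw [h2] at hn
  have hsum : 2 + n * 2 ≤ 6 := by simpa [hn] using sum_cycleType_le g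
  rw [sign_of_cycleType, hn] at hs
  obtain rfl | rfl | rfl : n = 0 ∨ n = 1 ∨ n = 2 := by omega
  · exact .inl hn
  · exact absurd hs (by decide)
  · exact .inr hn

lemma cycleType_of_orderOf_eq_six {g : Perm (Fin 6)} (h6 : orderOf g = 6) :
    g.cycleType = {6} ∨ g.cycleType = {3, 2} := by
  have hsum := sum_cycleType_le g
  have htwo : ∀ n ∈ g.cycleType, 2 ≤ n := fun n => two_le_of_mem_cycleType
  rw [← lcm_cycleType] at h6
  generalize g.cycleType = m at *
  rw [Fintype.card_fin] at hsum
  induction m using Multiset.induction with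
  | empty => simp at h6
  | cons a m _ =>
  induction m using Multiset.induction with
  | empty => left; simpa using h6
  | cons b m _ =>
  simp only [Multiset.mem_cons, forall_eq_or_imp, Multiset.sum_cons] at htwo hsum
  obtain ⟨ha, hb, hm⟩ := htwo
  induction m using Multiset.induction with
  | empty =>
    rw [Multiset.sum_zero] at hsum
    have ha' : a ≤ 4 := by omega
    have hb' : b ≤ 4 := by omega
    interval_cases a <;> interval_cases b <;> first | omega | (revert h6; decide)
  | cons c m _ =>
    simp only [Multiset.mem_cons, forall_eq_or_imp, Multiset.sum_cons] at hm hsum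
    obtain ⟨hc, hm⟩ := hm
    obtain rfl : m = 0 := Multiset.eq_zero_of_forall_notMem fun d hd => by
      have := hm d hd
      have := Multiset.single_le_sum (fun _ _ => Nat.zero_le _) d hd
      omega
    rw [Multiset.sum_zero] at hsum
    obtain ⟨rfl, rfl, rfl⟩ : a = 2 ∧ b = 2 ∧ c = 2 := by omega
    exact absurd h6 (by decide)

lemma cycleType_pow_of_cycleType_six {g : Perm (Fin 6)} (hg : g.cycleType = {6}) :
    (g ^ 2).cycleType = {3, 3} ∧ (g ^ 3).cycleType = {2, 2, 2} := by
  have h : g.cycleType = (finRotate 6).cycleType := hg.trans (by decide)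
  exact ⟨(cycleType_pow_congr h 2).trans (by decide), (cycleType_pow_congr h 3).trans (by decide)⟩

lemma cycleType_pow_of_cycleType_three_two {g : Perm (Fin 6)} (hg : g.cycleType = {3, 2}) :
    (g ^ 2).cycleType = {3} ∧ (g ^ 3).cycleType = {2} := by
  have h : g.cycleType = (swap 0 1 * swap 1 2 * swap 3 4 : Perm (Fin 6)).cycleType :=
    hg.trans (by decide)
  exact ⟨(cycleType_pow_congr h 2).trans (by decide), (cycleType_pow_congr h 3).trans (by decide)⟩

lemma cycleType_map_of_isSwap {φ : Perm (Fin 6) ≃* Perm (Fin 6)}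
    (hφ : ¬ ∃ x : Perm (Fin 6), ∀ g, φ g = x * g * x⁻¹) {g : Perm (Fin 6)}
    (hg : g.cycleType = {2}) : (φ g).cycleType = {2, 2, 2} := by
  by_contra hne
  refine hφ (exists_conj_of_map_isSwap (by simp) φ fun t ht => ?_)
  have ht2 : t.cycleType = {2} := isSwap_iff_cycleType.mp ht
  rw [isSwap_iff_cycleType, cycleType_map_congr φ (ht2.trans hg.symm)]
  refine (cycleType_of_orderOf_eq_two_of_sign ?_ ?_).resolve_right hne
  · rw [φ.orderOf_eq, ← lcm_cycleType, hg]; rfl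
  · rw [sign_map_mulEquiv, sign_of_cycleType, hg]; rfl

lemma cycleType_map_of_cycleType_two_two_two {φ : Perm (Fin 6) ≃* Perm (Fin 6)}
    (hφ : ¬ ∃ x : Perm (Fin 6), ∀ g, φ g = x * g * x⁻¹) {g : Perm (Fin 6)}
    (hg : g.cycleType = {2, 2, 2}) : (φ g).cycleType = {2} := by
  refine (cycleType_of_orderOf_eq_two_of_sign ?_ ?_).resolve_right fun h => ?_
  · rw [φ.orderOf_eq, ← lcm_cycleType, hg]; rfl
  · rw [sign_map_mulEquiv, sign_of_cycleType, hg]; rfl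
  · have ht : (swap 0 1 : Perm (Fin 6)).cycleType = {2} := by decide
    have := cycleType_map_congr φ.symm (h.trans (cycleType_map_of_isSwap hφ ht).symm)
    rw [φ.symm_apply_apply, φ.symm_apply_apply, hg, ht] at this
    exact absurd this (by decide)

lemma cycleType_map_of_cycleType_six {φ : Perm (Fin 6) ≃* Perm (Fin 6)}
    (hφ : ¬ ∃ x : Perm (Fin 6), ∀ g, φ g = x * g * x⁻¹) {g : Perm (Fin 6)}
    (hg : g.cycleType = {6}) : (φ g).cycleType = {3, 2} := by
  refine (cycleType_of_orderOf_eq_six ?_).resolve_left fun h => ?_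
  · rw [φ.orderOf_eq, ← lcm_cycleType, hg]; rfl
  · have h₁ := cycleType_map_of_cycleType_two_two_two hφ (cycleType_pow_of_cycleType_six hg).2
    rw [map_pow, (cycleType_pow_of_cycleType_six h).2] at h₁
    exact absurd h₁ (by decide)

lemma cycleType_map_of_cycleType_three_two {φ : Perm (Fin 6) ≃* Perm (Fin 6)}
    (hφ : ¬ ∃ x : Perm (Fin 6), ∀ g, φ g = x * g * x⁻¹) {g : Perm (Fin 6)}
    (hg : g.cycleType = {3, 2}) : (φ g).cycleType = {6} := by
  refine (cycleType_of_orderOf_eq_six ?_).resolve_right fun h => ?_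
  · rw [φ.orderOf_eq, ← lcm_cycleType, hg]; rfl
  · have h₁ := cycleType_map_of_isSwap hφ (cycleType_pow_of_cycleType_three_two hg).2
    rw [map_pow, (cycleType_pow_of_cycleType_three_two h).2] at h₁
    exact absurd h₁ (by decide)


/-- Any outer automorphism of `S₆` interchanges the conjugacy classes of cycle types
`{6} ↔ {3,2}`, `{3,3} ↔ {3}` and `{2,2,2} ↔ {2}`. -/
theorem outer_aut_S6_swaps_classes (φ : Equiv.Perm (Fin 6) ≃* Equiv.Perm (Fin 6))
    (hφ : ¬ ∃ x : Equiv.Perm (Fin 6), ∀ g : Equiv.Perm (Fin 6), φ g = x * g * x⁻¹) :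
    ∀ g : Equiv.Perm (Fin 6),
      (g.cycleType = {6} → (φ g).cycleType = {3, 2}) ∧
      (g.cycleType = {3, 2} → (φ g).cycleType = {6}) ∧
      (g.cycleType = {3, 3} → (φ g).cycleType = {3}) ∧
      (g.cycleType = {3} → (φ g).cycleType = {3, 3}) ∧
      (g.cycleType = {2, 2, 2} → (φ g).cycleType = {2}) ∧
      (g.cycleType = {2} → (φ g).cycleType = {2, 2, 2}) := by
  intro g
  refine ⟨cycleType_map_of_cycleType_six hφ, cycleType_map_of_cycleType_three_two hφ,
    fun hg => ?_, fun hg => ?_, cycleType_map_of_cycleType_two_two_two hφ,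
    cycleType_map_of_isSwap hφ⟩
  · obtain ⟨h, hh⟩ := (exists_with_cycleType_iff (Fin 6) (m := {6})).mpr (by decide)
    rw [cycleType_map_congr φ (hg.trans (cycleType_pow_of_cycleType_six hh).1.symm), map_pow]
    exact (cycleType_pow_of_cycleType_three_two (cycleType_map_of_cycleType_six hφ hh)).1
  · obtain ⟨h, hh⟩ := (exists_with_cycleType_iff (Fin 6) (m := {3, 2})).mpr (by decide)
    rw [cycleType_map_congr φ (hg.trans (cycleType_pow_of_cycleType_three_two hh).1.symm), map_pow]
    exact (cycleType_pow_of_cycleType_six (cycleType_map_of_cycleType_three_two hφ hh)).1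
end

section
/- Let G = C₂ × D₈ be the direct product of a cyclic group of order 2 and the dihedral group of order 8. Let cAut(G) be the group of all bijections σ of the set of irreducible characters of G such that (σ, τ) is a table automorphism of G for some bijection τ of the set of conjugacy classes of G, acting naturally on the set of irreducible characters of G; and let clAut(G) be the group of all bijections τ of the set of conjugacy classes of G such that (σ, τ) is a table automorphism of G for some σ, acting naturally on the set of conjugacy classes of G. Then cAut(G) and clAut(G) are isomorphic as abstract groups, but they are not permutation isomorphic: there is no bijection e from the set of irreducible characters of G to the set of conjugacy classes of G together with a group isomorphism θ : cAut(G) → clAut(G) such that e(σ(x)) = θ(σ)(e(x)) for every σ ∈ cAut(G) and every irreducible character x of G. -/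
/-- `f : G → ℂ` is an irreducible character of `G` if it is the character of some
irreducible (simple) finite-dimensional complex representation of `G`. -/
def IsIrrChar (G : Type) [Group G] (f : G → ℂ) : Prop :=
  ∃ V : FDRep ℂ G, CategoryTheory.Simple V ∧ f = V.character

/-- `(σ, τ)` is a table automorphism of `G`: `σ` permutes the irreducible characters,
`τ` permutes the conjugacy classes, and for every irreducible character `f`, every `g`,
and every `h` whose conjugacy class is `τ` of the class of `g`, `(σ f) h = f g`. -/
def IsTableAut (G : Type) [Group G]
    (σ : Equiv.Perm {f : G → ℂ // IsIrrChar G f})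
    (τ : Equiv.Perm (ConjClasses G)) : Prop :=
  ∀ (f : {f : G → ℂ // IsIrrChar G f}) (g h : G),
    ConjClasses.mk h = τ (ConjClasses.mk g) → (σ f).1 h = f.1 g

/-- The group `C₂ × D₈`, the direct product of a cyclic group of order 2 and the
dihedral group of order 8. -/
abbrev C2D8 : Type := Multiplicative (ZMod 2) × DihedralGroup 4

open CategoryTheory

section General

variable {G : Type} [Group G]

/-- The trace of an integral matrix representation whose character has norm one is an irreducible
character. -/
lemma isIrrChar_trace_of_norm_one [Fintype G] {n : ℕ} (X : G →* Matrix (Fin n) (Fin n) ℤ)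
    (hX : ∑ g : G, (X g).trace * (X g⁻¹).trace = Fintype.card G) :
    IsIrrChar G fun g => ((X g).trace : ℂ) := by
  let ρ : Representation ℂ G (Fin n → ℂ) :=
    ((Matrix.toLinAlgEquiv' (R := ℂ) (n := Fin n)).toRingEquiv.toMonoidHom).comp
      (((Int.castRingHom ℂ).mapMatrix (m := Fin n)).toMonoidHom.comp X)
  have hρ (g : G) : (FDRep.of ρ).character g = ((X g).trace : ℂ) := by
    change LinearMap.trace ℂ _ (Matrix.toLin' ((X g).map (Int.castRingHom ℂ))) = _
    rw [Matrix.trace_toLin'_eq]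
    simp [Matrix.trace]
  refine ⟨FDRep.of ρ, ?_, (funext hρ).symm⟩
  rw [FDRep.simple_iff_char_is_norm_one]
  simp only [hρ, Nat.card_eq_fintype_card]
  exact_mod_cast hX

/-- If a family of irreducible characters sums, with multiplicities given by degrees, to the
character of the regular representation, then it contains every irreducible character. -/
lemma exists_eq_of_isIrrChar [Fintype G] [DecidableEq G] {ι : Type} [Fintype ι] (χ : ι → G → ℤ)
    (hχ : ∀ i, IsIrrChar G fun g => (χ i g : ℂ))
    (hreg : ∀ g, ∑ i, χ i 1 * χ i g = if g = 1 then (Fintype.card G : ℤ) else 0)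
    {f : G → ℂ} (hf : IsIrrChar G f) : ∃ i, f = fun g => (χ i g : ℂ) := by
  obtain ⟨V, hV, rfl⟩ := hf
  by_contra! hne
  have := invertibleOfNonzero (NeZero.ne (Nat.card G : ℂ))
  have horth (i : ι) : ∑ g : G, (χ i g : ℂ) * V.character g⁻¹ = 0 := by
    obtain ⟨W, hW, hWχ⟩ := hχ i
    have h := FDRep.char_orthonormal W V
    rw [if_neg fun ⟨φ⟩ => hne i ((FDRep.char_iso φ).symm.trans hWχ.symm), ← hWχ] at h
    simpa using h
  have hone : (Fintype.card G : ℂ) * V.character 1 = 0 := by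
    calc (Fintype.card G : ℂ) * V.character 1
        = ∑ g : G, ((if g = 1 then (Fintype.card G : ℤ) else 0 : ℤ) : ℂ) * V.character g⁻¹ := by
          simp [Finset.sum_ite_eq', ite_mul]
      _ = ∑ g : G, ((∑ i, χ i 1 * χ i g : ℤ) : ℂ) * V.character g⁻¹ := by simp only [hreg]
      _ = ∑ i, (χ i 1 : ℂ) * ∑ g : G, (χ i g : ℂ) * V.character g⁻¹ := by
          push_cast
          simp only [Finset.sum_mul, Finset.mul_sum]
          rw [Finset.sum_comm]
          simp only [mul_assoc]
      _ = 0 := by simp [horth]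
  have hrank : Module.finrank ℂ V = 0 := by simpa using hone
  have : Subsingleton V := Module.finrank_zero_iff.mp hrank
  have hzero (g : G) : V.character g = 0 := by
    have : V.ρ g = 0 := LinearMap.ext fun _ => Subsingleton.elim _ _
    simp [FDRep.character, this]
  have hnorm := (FDRep.simple_iff_char_is_norm_one V).mp hV
  simp only [hzero, mul_zero, Finset.sum_const_zero] at hnorm
  exact NeZero.ne (Nat.card G : ℂ) hnorm.symm

/-- The group of table automorphisms of `G`. -/
def tableAut (G : Type) [Group G] :
    Subgroup (Equiv.Perm {f : G → ℂ // IsIrrChar G f} × Equiv.Perm (ConjClasses G)) where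
  carrier := {p | IsTableAut G p.1 p.2}
  one_mem' f g h hgh := by
    obtain ⟨V, -, hV⟩ := f.2
    obtain ⟨c, rfl⟩ := isConj_iff.mp (ConjClasses.mk_eq_mk_iff_isConj.mp hgh.symm)
    simp [hV]
  mul_mem' {p q} hp hq f g h hgh := by
    obtain ⟨k, hk⟩ := ConjClasses.mk_surjective (q.2 (ConjClasses.mk g))
    exact (hp (q.1 f) k h (by simpa [hk] using hgh)).trans (hq f g k hk)
  inv_mem' {p} hp f g h hgh := by
    have := hp (p.1⁻¹ f) h g (by simp [hgh])
    simpa using this.symm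

lemma mem_tableAut {p : Equiv.Perm {f : G → ℂ // IsIrrChar G f} × Equiv.Perm (ConjClasses G)} :
    p ∈ tableAut G ↔ IsTableAut G p.1 p.2 := Iff.rfl

lemma IsTableAut.eq_one_left {σ : Equiv.Perm {f : G → ℂ // IsIrrChar G f}}
    (h : IsTableAut G σ 1) : σ = 1 := by
  ext f g
  exact h f g g rfl

lemma IsTableAut.eq_one_right
    (hsep : ∀ g h : G, (∀ f, IsIrrChar G f → f g = f h) → IsConj g h)
    {τ : Equiv.Perm (ConjClasses G)} (hτ : IsTableAut G 1 τ) : τ = 1 := by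
  ext c
  obtain ⟨g, rfl⟩ := ConjClasses.mk_surjective c
  obtain ⟨h, hh⟩ := ConjClasses.mk_surjective (τ (ConjClasses.mk g))
  rw [← hh]
  exact ConjClasses.mk_eq_mk_iff_isConj.mpr (hsep h g fun f hf => hτ ⟨f, hf⟩ g h hh)

/-- The group of character parts of table automorphisms of `G`. -/
def cAut (G : Type) [Group G] : Subgroup (Equiv.Perm {f : G → ℂ // IsIrrChar G f}) :=
  (tableAut G).map (MonoidHom.fst _ _)

/-- The group of class parts of table automorphisms of `G`. -/
def clAut (G : Type) [Group G] : Subgroup (Equiv.Perm (ConjClasses G)) :=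
  (tableAut G).map (MonoidHom.snd _ _)

lemma mem_cAut {σ : Equiv.Perm {f : G → ℂ // IsIrrChar G f}} :
    σ ∈ cAut G ↔ ∃ τ, IsTableAut G σ τ := by
  simp [cAut, mem_tableAut]

lemma mem_clAut {τ : Equiv.Perm (ConjClasses G)} :
    τ ∈ clAut G ↔ ∃ σ, IsTableAut G σ τ := by
  simp [clAut, mem_tableAut]

/-- If irreducible characters separate conjugacy classes, then `cAut G` and `clAut G` are
isomorphic. -/
lemma nonempty_cAut_mulEquiv_clAut
    (hsep : ∀ g h : G, (∀ f, IsIrrChar G f → f g = f h) → IsConj g h) :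
    Nonempty (cAut G ≃* clAut G) := by
  have hfst : Function.Injective ((MonoidHom.fst _ _).subgroupMap (tableAut G)) := by
    rw [injective_iff_map_eq_one]
    rintro ⟨⟨σ, τ⟩, h⟩ hp
    obtain rfl : σ = 1 := congrArg Subtype.val hp
    obtain rfl : τ = 1 := IsTableAut.eq_one_right hsep h
    rfl
  have hsnd : Function.Injective ((MonoidHom.snd _ _).subgroupMap (tableAut G)) := by
    rw [injective_iff_map_eq_one]
    rintro ⟨⟨σ, τ⟩, h⟩ hp
    obtain rfl : τ = 1 := congrArg Subtype.val hp
    obtain rfl : σ = 1 := IsTableAut.eq_one_left h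
    rfl
  exact ⟨(MulEquiv.ofBijective _ ⟨hfst, MonoidHom.subgroupMap_surjective _ _⟩).symm.trans
    (MulEquiv.ofBijective _ ⟨hsnd, MonoidHom.subgroupMap_surjective _ _⟩)⟩

/-- A class which is singled out by the set of values of the irreducible characters on it is fixed
by every table automorphism. -/
lemma IsTableAut.apply_mk_eq {σ : Equiv.Perm {f : G → ℂ // IsIrrChar G f}}
    {τ : Equiv.Perm (ConjClasses G)} (hστ : IsTableAut G σ τ) (S : Set ℂ) {g : G}
    (hg : ∀ f, IsIrrChar G f → f g ∈ S)
    (huniq : ∀ h, (∀ f, IsIrrChar G f → f h ∈ S) → h = g) :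
    τ (ConjClasses.mk g) = ConjClasses.mk g := by
  obtain ⟨h, hh⟩ := ConjClasses.mk_surjective (τ (ConjClasses.mk g))
  rw [← hh, huniq h]
  intro f hf
  have := hστ (σ.symm ⟨f, hf⟩) g h hh
  rw [Equiv.apply_symm_apply] at this
  exact Set.mem_of_eq_of_mem this (hg _ (σ.symm ⟨f, hf⟩).2)

/-- A permutation of the labels of the irreducible characters and a self-map of `G` compatible with
the character values give rise to a table automorphism. -/
lemma exists_isTableAut [Finite G] {ι : Type} (χ : ι → G → ℂ)
    (e : ι ≃ {f : G → ℂ // IsIrrChar G f}) (he : ∀ i, (e i).1 = χ i)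
    (hsep : ∀ g h, (∀ i, χ i g = χ i h) → IsConj g h)
    (s : Equiv.Perm ι) (t : G → G) (hst : ∀ i g, χ (s i) (t g) = χ i g) :
    ∃ τ, IsTableAut G (e.permCongr s) τ := by
  have hclass (i : ι) {g h : G} (hgh : IsConj g h) : χ i g = χ i h := by
    obtain ⟨V, -, hV⟩ := (e i).2
    obtain ⟨c, rfl⟩ := isConj_iff.mp hgh
    simp [← he, hV]
  let T : ConjClasses G → ConjClasses G := Quotient.map t fun g h hgh =>
    hsep _ _ fun i => by
      have := hclass (s.symm i) hgh
      rwa [← hst _ g, ← hst _ h, Equiv.apply_symm_apply] at this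
  have hT : Function.Injective T := by
    intro c d hcd
    obtain ⟨g, rfl⟩ := ConjClasses.mk_surjective c
    obtain ⟨h, rfl⟩ := ConjClasses.mk_surjective d
    have hconj : IsConj (t g) (t h) := ConjClasses.mk_eq_mk_iff_isConj.mp hcd
    refine ConjClasses.mk_eq_mk_iff_isConj.mpr (hsep _ _ fun i => ?_)
    rw [← hst i g, ← hst i h, hclass (s i) hconj]
  refine ⟨Equiv.ofBijective T (Finite.injective_iff_bijective.mp hT), fun f g h hgh => ?_⟩
  obtain ⟨i, rfl⟩ := e.surjective f
  have hconj : IsConj h (t g) := ConjClasses.mk_eq_mk_iff_isConj.mp hgh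
  simp only [Equiv.permCongr_apply, Equiv.symm_apply_apply, he]
  rw [hclass _ hconj, hst]

end General

namespace C2D8

/-- The integer `(-1) ^ a`. -/
def sign (a : ZMod 2) : ℤ := if a = 0 then 1 else -1

/-- The reduction of a residue modulo `4` to a residue modulo `2`. -/
def parity (k : ZMod 4) : ZMod 2 := ZMod.castHom (by decide : 2 ∣ 4) (ZMod 2) k

/-- The coordinates of an element of `C₂ × D₈` in its abelianization `C₂ × C₂ × C₂`. -/
def coords : C2D8 → ZMod 2 × ZMod 2 × ZMod 2
  | (x, .r k) => (x.toAdd, parity k, 0)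
  | (x, .sr k) => (x.toAdd, parity k, 1)

/-- The linear representation of `C₂ × D₈` with the given dual coordinates. -/
def linRep (v : ZMod 2 × ZMod 2 × ZMod 2) : C2D8 →* Matrix (Fin 1) (Fin 1) ℤ where
  toFun g := Matrix.of fun _ _ =>
    sign (v.1 * (coords g).1 + v.2.1 * (coords g).2.1 + v.2.2 * (coords g).2.2)
  map_one' := by revert v; decide +kernel
  map_mul' := by revert v; decide +kernel

/-- The natural representation of `D₈` by symmetries of a square. -/
def squareMatrix : DihedralGroup 4 → Matrix (Fin 2) (Fin 2) ℤ
  | .r k => !![0, -1; 1, 0] ^ k.val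
  | .sr k => !![1, 0; 0, -1] * !![0, -1; 1, 0] ^ k.val

/-- The representation of `C₂ × D₈` on the plane with central character on `C₂` given by `a`. -/
def planeRep (a : ZMod 2) : C2D8 →* Matrix (Fin 2) (Fin 2) ℤ where
  toFun g := sign (a * g.1.toAdd) • squareMatrix g.2
  map_one' := by revert a; decide +kernel
  map_mul' := by revert a; decide +kernel

/-- Labels of the irreducible characters of `C₂ × D₈`. -/
abbrev Label : Type := (ZMod 2 × ZMod 2 × ZMod 2) ⊕ ZMod 2

/-- The character table of `C₂ × D₈`. -/
def table : Label → C2D8 → ℤ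
  | .inl v, g => (linRep v g).trace
  | .inr a, g => (planeRep a g).trace

lemma isIrrChar_table (i : Label) : IsIrrChar C2D8 fun g => (table i g : ℂ) := by
  rcases i with v | a
  · exact isIrrChar_trace_of_norm_one (linRep v) (by revert v; decide +kernel)
  · exact isIrrChar_trace_of_norm_one (planeRep a) (by revert a; decide +kernel)

lemma isIrrChar_iff {f : C2D8 → ℂ} : IsIrrChar C2D8 f ↔ ∃ i, f = fun g => (table i g : ℂ) :=
  ⟨exists_eq_of_isIrrChar table isIrrChar_table (by decide +kernel), by
    rintro ⟨i, rfl⟩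
    exact isIrrChar_table i⟩

lemma isConj_of_table_eq : ∀ g h : C2D8, (∀ i, table i g = table i h) → IsConj g h := by
  decide +kernel

lemma table_injective : ∀ i j : Label, (∀ g, table i g = table j g) → i = j := by
  decide +kernel

/-- The irreducible characters of `C₂ × D₈` are labelled by the rows of its character table. -/
noncomputable def labelEquiv : Label ≃ {f : C2D8 → ℂ // IsIrrChar C2D8 f} :=
  Equiv.ofBijective (fun i => ⟨_, isIrrChar_table i⟩)
    ⟨fun i j hij => table_injective i j fun g => by
      have : (table i g : ℂ) = table j g := congrFun (congrArg Subtype.val hij) g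
      exact_mod_cast this,
    fun ⟨_, hf⟩ => (isIrrChar_iff.mp hf).imp fun _ h => Subtype.ext h.symm⟩

lemma isConj_of_isIrrChar (g h : C2D8) (hgh : ∀ f, IsIrrChar C2D8 f → f g = f h) :
    IsConj g h :=
  isConj_of_table_eq g h fun i => by exact_mod_cast hgh _ (isIrrChar_table i)

/-- A compatible pair of a permutation of labels and a self-map of `C₂ × D₈` gives an element of
`cAut`. -/
lemma permCongr_mem_cAut (s : Equiv.Perm Label) (t : C2D8 → C2D8)
    (hst : ∀ i g, table (s i) (t g) = table i g) : labelEquiv.permCongr s ∈ cAut C2D8 :=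
  mem_cAut.mpr <| exists_isTableAut (fun i g => (table i g : ℂ)) labelEquiv (fun _ => rfl)
    (fun g h hgh => isConj_of_table_eq g h fun i => by exact_mod_cast hgh i) s t
    fun i g => by exact_mod_cast hst i g

/-- A permutation of labels of order three. -/
def rotateLabel : Equiv.Perm Label where
  toFun
    | .inl (a, b, c) => .inl (a, b + c, b)
    | .inr a => .inr a
  invFun
    | .inl (a, b, c) => .inl (a, c, b + c)
    | .inr a => .inr a
  left_inv := by decide +kernel
  right_inv := by decide +kernel

/-- A map on elements compatible with `rotateLabel`. -/
def rotate : C2D8 → C2D8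
  | (x, .r k) => if parity k = 0 then (x, .r k) else (x, .sr (k - 1))
  | (x, .sr k) => if parity k = 0 then (x, .sr (k + 1)) else (x, .r k)

/-- An involution on labels exchanging the two characters of degree two. -/
def shearLabel : Equiv.Perm Label where
  toFun
    | .inl (a, b, c) => .inl (a, b + a, c)
    | .inr a => .inr (a + 1)
  invFun
    | .inl (a, b, c) => .inl (a, b + a, c)
    | .inr a => .inr (a + 1)
  left_inv := by decide +kernel
  right_inv := by decide +kernel

/-- A map on elements compatible with `shearLabel`. -/
def shear : C2D8 → C2D8
  | (x, .r k) =>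
    if parity k = 0 then (x, .r (k + 2 * (x.toAdd.val : ZMod 4)))
    else (x * Multiplicative.ofAdd 1, .r k)
  | (x, .sr k) => (x * Multiplicative.ofAdd (parity k), .sr k)

/-- At most one irreducible character is fixed by all of `cAut`. -/
lemma eq_of_fixed_by_cAut {f : {f : C2D8 → ℂ // IsIrrChar C2D8 f}}
    (hf : ∀ σ ∈ cAut C2D8, σ f = f) : f = labelEquiv (.inl 0) := by
  obtain ⟨i, rfl⟩ := labelEquiv.surjective f
  have hrotate := hf _ (permCongr_mem_cAut rotateLabel rotate (by decide +kernel))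
  have hshear := hf _ (permCongr_mem_cAut shearLabel shear (by decide +kernel))
  simp only [Equiv.permCongr_apply, Equiv.symm_apply_apply, labelEquiv.apply_eq_iff_eq]
    at hrotate hshear
  rw [labelEquiv.apply_eq_iff_eq]
  clear hf
  revert i
  decide +kernel

/-- A class singled out by the set of entries in its column of the character table is fixed by all
of `clAut`. -/
lemma clAut_apply_mk (S : Set ℤ) {g : C2D8} (hg : ∀ i, table i g ∈ S)
    (huniq : ∀ h, (∀ i, table i h ∈ S) → h = g) {τ : Equiv.Perm (ConjClasses C2D8)}
    (hτ : τ ∈ clAut C2D8) : τ (ConjClasses.mk g) = ConjClasses.mk g := by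
  obtain ⟨σ, hσ⟩ := mem_clAut.mp hτ
  refine hσ.apply_mk_eq ((↑) '' S) (fun f hf => ?_) fun h hh => huniq h fun i => ?_
  · obtain ⟨i, rfl⟩ := isIrrChar_iff.mp hf
    exact ⟨_, hg i, rfl⟩
  · obtain ⟨n, hn, hn'⟩ := hh _ (isIrrChar_table i)
    rwa [← Int.cast_injective hn']

lemma clAut_apply_one {τ : Equiv.Perm (ConjClasses C2D8)} (hτ : τ ∈ clAut C2D8) :
    τ (ConjClasses.mk 1) = ConjClasses.mk 1 :=
  clAut_apply_mk {n | 0 < n} (by simp only [Set.mem_ofPred_eq]; decide +kernel)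
    (by simp only [Set.mem_ofPred_eq]; decide +kernel) hτ

lemma clAut_apply_r_two {τ : Equiv.Perm (ConjClasses C2D8)} (hτ : τ ∈ clAut C2D8) :
    τ (ConjClasses.mk (1, .r 2)) = ConjClasses.mk (1, .r 2) :=
  clAut_apply_mk {n | n = 1 ∨ n = -2} (by simp only [Set.mem_ofPred_eq]; decide +kernel)
    (by simp only [Set.mem_ofPred_eq]; decide +kernel) hτ

lemma mk_one_ne_mk_r_two : (ConjClasses.mk 1 : ConjClasses C2D8) ≠ ConjClasses.mk (1, .r 2) := by
  rw [Ne, ConjClasses.mk_eq_mk_iff_isConj, isConj_one_right]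
  decide

end C2D8

/-- For `G = C₂ × D₈`, the groups `cAut(G)` (the group of all `σ` such that `(σ, τ)` is a
table automorphism for some `τ`) and `clAut(G)` (the group of all `τ` such that `(σ, τ)` is a
table automorphism for some `σ`) are isomorphic as abstract groups, but are not
permutation isomorphic. -/
theorem cAut_clAut_isomorphic_not_permutation_isomorphic :
    ∃ (A : Subgroup (Equiv.Perm {f : C2D8 → ℂ // IsIrrChar C2D8 f}))
      (B : Subgroup (Equiv.Perm (ConjClasses C2D8))),
      (A : Set (Equiv.Perm {f : C2D8 → ℂ // IsIrrChar C2D8 f})) =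
        {σ | ∃ τ, IsTableAut C2D8 σ τ} ∧
      (B : Set (Equiv.Perm (ConjClasses C2D8))) =
        {τ | ∃ σ, IsTableAut C2D8 σ τ} ∧
      Nonempty (A ≃* B) ∧
      ¬ ∃ (e : {f : C2D8 → ℂ // IsIrrChar C2D8 f} ≃ ConjClasses C2D8) (θ : A ≃* B),
        ∀ (σ : A) (x : {f : C2D8 → ℂ // IsIrrChar C2D8 f}),
          e ((σ : Equiv.Perm {f : C2D8 → ℂ // IsIrrChar C2D8 f}) x) =
            (θ σ : Equiv.Perm (ConjClasses C2D8)) (e x) := by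
  refine ⟨cAut C2D8, clAut C2D8, Set.ext fun _ => mem_cAut, Set.ext fun _ => mem_clAut,
    nonempty_cAut_mulEquiv_clAut C2D8.isConj_of_isIrrChar, ?_⟩
  rintro ⟨e, θ, h⟩
  have key (c : ConjClasses C2D8) (hc : ∀ τ ∈ clAut C2D8, τ c = c) :
      e.symm c = C2D8.labelEquiv (.inl 0) :=
    C2D8.eq_of_fixed_by_cAut fun σ hσ => by
      rw [e.eq_symm_apply, h ⟨σ, hσ⟩, e.apply_symm_apply]
      exact hc _ (θ ⟨σ, hσ⟩).2
  exact C2D8.mk_one_ne_mk_r_two <| e.symm.injective <|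
    (key _ fun _ => C2D8.clAut_apply_one).trans (key _ fun _ => C2D8.clAut_apply_r_two).symm
end
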